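/- For every integer k ≥ 3, the k-th derivative of the inverse Mills ratio is bounded: sup_{x ∈ ℝ} |𝒜^{(k)}(x)| < ∞. (Lemma 4.4, item (v).) -/

import Mathlib

open MeasureTheory ProbabilityTheory

/-- The standard Gaussian measure on `ℝ`. -/
noncomputable def stdGauss : Measure ℝ := gaussianReal 0 1

/-- The Gaussian tail function `𝒩(x) = P(Z ≥ x)`. -/
noncomputable def gaussTail (x : ℝ) : ℝ := (stdGauss (Set.Ici x)).toReal

/-- The inverse Mills ratio `𝒜(x) = e^{-x²/2} / (√(2π)·𝒩(x))`. -/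
noncomputable def invMills (x : ℝ) : ℝ :=
  Real.exp (-x ^ 2 / 2) / (Real.sqrt (2 * Real.pi) * gaussTail x)

/-- The moment of order `j` of the standard Gaussian restricted to `[0, ∞)` and weighted by
`t ↦ exp (-x t)`. -/
noncomputable def halfMoment (j : ℕ) (x : ℝ) : ℝ :=
  ∫ t in Set.Ici 0, t ^ j * Real.exp (-x * t) ∂stdGauss

lemma mem_interior_integrableExpSet_stdGauss_restrict (x : ℝ) :
    x ∈ interior (integrableExpSet id (stdGauss.restrict (Set.Ici 0))) := by
  have : integrableExpSet id (stdGauss.restrict (Set.Ici 0)) = Set.univ := by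
    ext t
    simpa [integrableExpSet, stdGauss] using (integrable_exp_mul_gaussianReal t).restrict
  simp [this]

lemma integrable_pow_mul_exp_stdGauss_restrict (j : ℕ) (x : ℝ) :
    Integrable (fun t ↦ t ^ j * Real.exp (-x * t)) (stdGauss.restrict (Set.Ici 0)) :=
  integrable_pow_mul_exp_of_mem_interior_integrableExpSet
    (mem_interior_integrableExpSet_stdGauss_restrict (-x)) j

lemma hasDerivAt_halfMoment (j : ℕ) (x : ℝ) :
    HasDerivAt (halfMoment j) (-halfMoment (j + 1) x) x := by
  have h := (hasDerivAt_integral_pow_mul_exp_real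
    (mem_interior_integrableExpSet_stdGauss_restrict (-x)) j).comp x (hasDerivAt_neg x)
  rw [mul_neg_one] at h
  exact h

lemma halfMoment_nonneg (j : ℕ) (x : ℝ) : 0 ≤ halfMoment j x :=
  setIntegral_nonneg measurableSet_Ici fun t (ht : 0 ≤ t) ↦ by positivity

lemma gaussTail_eq_integral (x : ℝ) :
    gaussTail x = ∫ t in Set.Ioi x, gaussianPDFReal 0 1 t := by
  rw [gaussTail, stdGauss, gaussianReal_apply_eq_integral 0 one_ne_zero, ENNReal.toReal_ofReal
    (setIntegral_nonneg measurableSet_Ici fun t _ ↦ gaussianPDFReal_nonneg 0 1 t),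
    integral_Ici_eq_integral_Ioi]

lemma hasDerivAt_gaussTail (x : ℝ) :
    HasDerivAt gaussTail (-gaussianPDFReal 0 1 x) x := by
  have hc : Continuous (gaussianPDFReal 0 1) := by
    rw [gaussianPDFReal_def]; fun_prop
  have hi := integrable_gaussianPDFReal 0 1
  have h : gaussTail = fun y ↦ gaussTail 0 - ∫ t in (0 : ℝ)..y, gaussianPDFReal 0 1 t := by
    ext y
    rw [gaussTail_eq_integral, gaussTail_eq_integral,
      ← intervalIntegral.integral_Ioi_sub_Ioi' hi.integrableOn hi.integrableOn]
    ring
  rw [h]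
  exact (intervalIntegral.integral_hasDerivAt_right (hc.intervalIntegrable _ _)
    (hc.stronglyMeasurableAtFilter _ _) hc.continuousAt).const_sub _

lemma gaussTail_pos (x : ℝ) : 0 < gaussTail x := by
  rw [gaussTail_eq_integral, setIntegral_pos_iff_support_of_nonneg_ae
    (Filter.Eventually.of_forall fun t ↦ gaussianPDFReal_nonneg 0 1 t)
    (integrable_gaussianPDFReal 0 1).integrableOn]
  have : Function.support (gaussianPDFReal 0 1) = Set.univ :=
    Set.eq_univ_of_forall fun t ↦ (gaussianPDFReal_pos 0 1 t one_ne_zero).ne'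
  simp [this]

lemma gaussTail_antitone : Antitone gaussTail := fun _ _ h ↦
  ENNReal.toReal_mono (by unfold stdGauss; exact measure_ne_top _ _)
    (measure_mono (Set.Ici_subset_Ici.2 h))

lemma halfMoment_zero (x : ℝ) : halfMoment 0 x = Real.exp (x ^ 2 / 2) * gaussTail x := by
  have h : gaussTail x = ∫ t in Set.Ici 0, gaussianPDFReal (-x) 1 t := by
    have hm := gaussianReal_map_sub_const (μ := 0) (v := 1) x
    have hp : (fun t : ℝ ↦ t - x) ⁻¹' Set.Ici 0 = Set.Ici x := by ext; simp
    rw [gaussTail, stdGauss, ← hp, ← Measure.map_apply (by fun_prop) measurableSet_Ici, hm,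
      zero_sub, gaussianReal_apply_eq_integral _ one_ne_zero, ENNReal.toReal_ofReal
      (setIntegral_nonneg measurableSet_Ici fun t _ ↦ gaussianPDFReal_nonneg _ 1 t)]
  rw [halfMoment, h, ← integral_indicator measurableSet_Ici, stdGauss,
    integral_gaussianReal_eq_integral_smul one_ne_zero, ← integral_const_mul,
    ← integral_indicator measurableSet_Ici]
  congr 1 with t
  by_cases ht : t ∈ Set.Ici (0 : ℝ)
  · simp only [Set.indicator_of_mem ht, gaussianPDFReal_def, smul_eq_mul, pow_zero, one_mul]
    rw [mul_left_comm, mul_assoc, ← Real.exp_add, ← Real.exp_add]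
    congr 2
    push_cast
    ring
  · simp [Set.indicator_of_notMem ht]

lemma halfMoment_zero_pos (x : ℝ) : 0 < halfMoment 0 x := by
  rw [halfMoment_zero]
  exact mul_pos (Real.exp_pos _) (gaussTail_pos x)

lemma halfMoment_one (x : ℝ) :
    halfMoment 1 x = (Real.sqrt (2 * Real.pi))⁻¹ - x * halfMoment 0 x := by
  have h1 := hasDerivAt_halfMoment 0 x
  have h2 : HasDerivAt (fun y : ℝ ↦ Real.exp (y ^ 2 / 2)) (Real.exp (x ^ 2 / 2) * x) x := by
    convert ((hasDerivAt_pow 2 x).div_const 2).exp using 1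
    simp
  have h3 := h2.mul (hasDerivAt_gaussTail x)
  have h4 : halfMoment 0 = (fun y : ℝ ↦ Real.exp (y ^ 2 / 2)) * gaussTail := by
    ext y; exact halfMoment_zero y
  rw [← h4] at h3
  have h5 := h1.unique h3
  have h6 : Real.exp (x ^ 2 / 2) * gaussianPDFReal 0 1 x = (Real.sqrt (2 * Real.pi))⁻¹ := by
    rw [gaussianPDFReal_def]
    simp only [NNReal.coe_one, mul_one, sub_zero]
    rw [mul_left_comm, ← Real.exp_add]
    ring_nf
    simp
  rw [halfMoment_zero]
  simp only [zero_add] at h5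
  linarith

lemma halfMoment_add_two (j : ℕ) (x : ℝ) :
    halfMoment (j + 2) x = (j + 1) * halfMoment j x - x * halfMoment (j + 1) x := by
  induction j generalizing x with
  | zero =>
    have h := ((hasDerivAt_id x).mul (hasDerivAt_halfMoment 0 x)).const_sub
      (Real.sqrt (2 * Real.pi))⁻¹
    have h' := hasDerivAt_halfMoment 1 x
    rw [show halfMoment 1 = _ from funext halfMoment_one] at h'
    have := h'.unique h
    simp only [id, zero_add, Nat.reduceAdd, Nat.cast_zero] at this ⊢
    linarith
  | succ j ih =>
    have h := ((hasDerivAt_halfMoment j x).const_mul ((j : ℝ) + 1)).sub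
      ((hasDerivAt_id x).mul (hasDerivAt_halfMoment (j + 1) x))
    have h' := hasDerivAt_halfMoment (j + 2) x
    rw [show halfMoment (j + 2) = _ from funext ih] at h'
    have := h'.unique h
    simp only [id] at this
    push_cast
    linarith

/-- The normalized moment of order `j` of the density proportional to `exp (-x t - t² / 2)` on
`[0, ∞)`. -/
noncomputable def millsMoment (j : ℕ) (x : ℝ) : ℝ := halfMoment j x / halfMoment 0 x

lemma millsMoment_nonneg (j : ℕ) (x : ℝ) : 0 ≤ millsMoment j x :=
  div_nonneg (halfMoment_nonneg j x) (halfMoment_nonneg 0 x)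

lemma millsMoment_zero (x : ℝ) : millsMoment 0 x = 1 := div_self (halfMoment_zero_pos x).ne'

lemma millsMoment_add_two (j : ℕ) (x : ℝ) :
    millsMoment (j + 2) x = (j + 1) * millsMoment j x - x * millsMoment (j + 1) x := by
  simp only [millsMoment, halfMoment_add_two]
  ring

lemma hasDerivAt_millsMoment (j : ℕ) (x : ℝ) :
    HasDerivAt (millsMoment j)
      (millsMoment 1 x * millsMoment j x - millsMoment (j + 1) x) x := by
  have h0 := (halfMoment_zero_pos x).ne'
  refine ((hasDerivAt_halfMoment j x).div (hasDerivAt_halfMoment 0 x) h0).congr_deriv ?_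
  simp only [millsMoment, zero_add]
  field_simp
  ring

lemma invMills_eq_div (x : ℝ) : invMills x = (Real.sqrt (2 * Real.pi))⁻¹ / halfMoment 0 x := by
  rw [halfMoment_zero, invMills, neg_div, Real.exp_neg]
  have := gaussTail_pos x
  field_simp

lemma invMills_eq_add_millsMoment_one (x : ℝ) : invMills x = x + millsMoment 1 x := by
  have := halfMoment_zero_pos x
  rw [invMills_eq_div, millsMoment, halfMoment_one]
  field_simp
  ring

lemma hasDerivAt_invMills (x : ℝ) :
    HasDerivAt invMills (invMills x * millsMoment 1 x) x := by
  have h0 := (halfMoment_zero_pos x).ne'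
  rw [show invMills = _ from funext invMills_eq_div]
  refine ((hasDerivAt_const x (Real.sqrt (2 * Real.pi))⁻¹).div
    (hasDerivAt_halfMoment 0 x) h0).congr_deriv ?_
  simp only [millsMoment, zero_add]
  field_simp
  ring

/-- Functions of polynomial growth at `-∞` that are bounded on `[0, ∞)`. -/
def NegPolyGrowth (f : ℝ → ℝ) : Prop :=
  ∃ (C : ℝ) (n : ℕ), 0 ≤ C ∧ ∀ x, |f x| ≤ C * (1 + max (-x) 0) ^ n

lemma one_le_one_add_max (x : ℝ) : 1 ≤ 1 + max (-x) 0 :=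
  le_add_of_nonneg_right (le_max_right _ _)

namespace NegPolyGrowth

lemma const (c : ℝ) : NegPolyGrowth fun _ ↦ c := ⟨|c|, 0, abs_nonneg c, by simp⟩

lemma add {f g : ℝ → ℝ} (hf : NegPolyGrowth f) (hg : NegPolyGrowth g) :
    NegPolyGrowth (f + g) := by
  obtain ⟨C, n, hC, hf⟩ := hf
  obtain ⟨D, m, hD, hg⟩ := hg
  refine ⟨C + D, n + m, by positivity, fun x ↦ (abs_add_le _ _).trans ?_⟩
  have h1 := one_le_one_add_max x
  rw [add_mul]
  exact add_le_add
    ((hf x).trans (mul_le_mul_of_nonneg_left (pow_le_pow_right₀ h1 (by omega)) hC))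
    ((hg x).trans (mul_le_mul_of_nonneg_left (pow_le_pow_right₀ h1 (by omega)) hD))

lemma mul {f g : ℝ → ℝ} (hf : NegPolyGrowth f) (hg : NegPolyGrowth g) :
    NegPolyGrowth (f * g) := by
  obtain ⟨C, n, hC, hf⟩ := hf
  obtain ⟨D, m, hD, hg⟩ := hg
  refine ⟨C * D, n + m, by positivity, fun x ↦ ?_⟩
  have h1 := one_le_one_add_max x
  rw [Pi.mul_apply, abs_mul, pow_add, mul_mul_mul_comm]
  exact mul_le_mul (hf x) (hg x) (abs_nonneg _) (by positivity)

end NegPolyGrowth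

lemma millsMoment_one_le (x : ℝ) : millsMoment 1 x ≤ 2 * (1 + max (-x) 0) := by
  set w := 1 + max (-x) 0 with hw
  have h1 : 1 ≤ w := one_le_one_add_max x
  have key : 2 * w * halfMoment 1 x ≤ w ^ 2 * halfMoment 0 x + halfMoment 2 x := by
    simp only [halfMoment]
    rw [← integral_const_mul, ← integral_const_mul, ← integral_add
      ((integrable_pow_mul_exp_stdGauss_restrict 0 x).const_mul _)
      (integrable_pow_mul_exp_stdGauss_restrict 2 x)]
    refine integral_mono ((integrable_pow_mul_exp_stdGauss_restrict 1 x).const_mul _)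
      (((integrable_pow_mul_exp_stdGauss_restrict 0 x).const_mul _).add
      (integrable_pow_mul_exp_stdGauss_restrict 2 x)) fun t ↦ ?_
    simp only
    nlinarith [mul_nonneg (sq_nonneg (w - t)) (Real.exp_pos (-x * t)).le]
  have key' : 2 * w * millsMoment 1 x ≤ w ^ 2 + millsMoment 2 x := by
    have h0 := halfMoment_zero_pos x
    simp only [millsMoment]
    field_simp
    linarith
  have h2 := millsMoment_add_two 0 x
  simp only [zero_add, Nat.cast_zero, millsMoment_zero] at h2
  have h3 : -x * millsMoment 1 x ≤ w * millsMoment 1 x :=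
    mul_le_mul_of_nonneg_right (by rw [hw]; linarith [le_max_left (-x) 0])
      (millsMoment_nonneg 1 x)
  have h4 : w * millsMoment 1 x ≤ w * (2 * w) := by nlinarith
  exact le_of_mul_le_mul_left h4 (by linarith)

lemma negPolyGrowth_millsMoment (j : ℕ) : NegPolyGrowth (millsMoment j) := by
  suffices h : NegPolyGrowth (millsMoment j) ∧ NegPolyGrowth (millsMoment (j + 1)) from h.1
  induction j with
  | zero =>
    refine ⟨⟨1, 0, zero_le_one, fun x ↦ by simp [millsMoment_zero]⟩,
      ⟨2, 1, zero_le_two, fun x ↦ ?_⟩⟩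
    rw [abs_of_nonneg (millsMoment_nonneg _ x), pow_one]
    exact millsMoment_one_le x
  | succ j ih =>
    refine ⟨ih.2, ?_⟩
    have hw : NegPolyGrowth fun x ↦ max (-x) 0 := ⟨1, 1, zero_le_one, fun x ↦ by
      rw [abs_of_nonneg (le_max_right _ _)]; linarith⟩
    obtain ⟨C, n, hC, h⟩ := ((NegPolyGrowth.const ((j : ℝ) + 1)).mul ih.1).add (hw.mul ih.2)
    refine ⟨C, n, hC, fun x ↦ le_trans ?_ ((le_abs_self _).trans (h x))⟩
    rw [abs_of_nonneg (millsMoment_nonneg _ x), millsMoment_add_two]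
    simp only [Pi.add_apply, Pi.mul_apply]
    nlinarith [mul_le_mul_of_nonneg_right (le_max_left (-x) 0) (millsMoment_nonneg (j + 1) x)]

/-- The algebra of polynomials in the moments `millsMoment j`. -/
noncomputable def millsAlgebra : Subalgebra ℝ (ℝ → ℝ) := Algebra.adjoin ℝ (Set.range millsMoment)

lemma millsMoment_mem_millsAlgebra (j : ℕ) : millsMoment j ∈ millsAlgebra :=
  Algebra.subset_adjoin ⟨j, rfl⟩

lemma negPolyGrowth_of_mem_millsAlgebra {f : ℝ → ℝ} (hf : f ∈ millsAlgebra) :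
    NegPolyGrowth f := by
  induction hf using Algebra.adjoin_induction with
  | mem f hf => obtain ⟨j, rfl⟩ := hf; exact negPolyGrowth_millsMoment j
  | algebraMap r => exact .const r
  | add f g _ _ hf hg => exact hf.add hg
  | mul f g _ _ hf hg => exact hf.mul hg

lemma exists_hasDerivAt_of_mem_millsAlgebra {f : ℝ → ℝ} (hf : f ∈ millsAlgebra) :
    ∃ g ∈ millsAlgebra, ∀ x, HasDerivAt f (g x) x := by
  induction hf using Algebra.adjoin_induction with
  | mem f hf =>
    obtain ⟨j, rfl⟩ := hf
    exact ⟨millsMoment 1 * millsMoment j - millsMoment (j + 1),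
      sub_mem (mul_mem (millsMoment_mem_millsAlgebra _) (millsMoment_mem_millsAlgebra _))
        (millsMoment_mem_millsAlgebra _), hasDerivAt_millsMoment j⟩
  | algebraMap r => exact ⟨0, zero_mem _, fun x ↦ hasDerivAt_const x r⟩
  | add f g _ _ hf hg =>
    obtain ⟨f', hf', hf⟩ := hf
    obtain ⟨g', hg', hg⟩ := hg
    exact ⟨f' + g', add_mem hf' hg', fun x ↦ (hf x).add (hg x)⟩
  | mul f g hfm hgm hf hg =>
    obtain ⟨f', hf', hf⟩ := hf
    obtain ⟨g', hg', hg⟩ := hg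
    exact ⟨f' * g + f * g', add_mem (mul_mem hf' hgm) (mul_mem hfm hg'),
      fun x ↦ (hf x).mul (hg x)⟩

lemma exists_iteratedDeriv_invMills_eq_mul (k : ℕ) :
    ∃ f ∈ millsAlgebra, iteratedDeriv k invMills = invMills * f := by
  induction k with
  | zero => exact ⟨1, one_mem _, by simp⟩
  | succ k ih =>
    obtain ⟨f, hf, h⟩ := ih
    obtain ⟨g, hg, hd⟩ := exists_hasDerivAt_of_mem_millsAlgebra hf
    refine ⟨millsMoment 1 * f + g,
      add_mem (mul_mem (millsMoment_mem_millsAlgebra 1) hf) hg, ?_⟩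
    ext x
    rw [iteratedDeriv_succ, h, ((hasDerivAt_invMills x).mul (hd x)).deriv]
    simp only [Pi.mul_apply, Pi.add_apply]
    ring

lemma iteratedDeriv_succ_invMills_mem (k : ℕ) :
    iteratedDeriv (k + 1) invMills ∈ millsAlgebra := by
  induction k with
  | zero =>
    obtain ⟨g, hg, hd⟩ := exists_hasDerivAt_of_mem_millsAlgebra (millsMoment_mem_millsAlgebra 1)
    convert add_mem (one_mem millsAlgebra) hg using 1
    ext x
    rw [zero_add, iteratedDeriv_one,
      show invMills = _ from funext invMills_eq_add_millsMoment_one]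
    exact ((hasDerivAt_id x).add (hd x)).deriv
  | succ k ih =>
    obtain ⟨g, hg, hd⟩ := exists_hasDerivAt_of_mem_millsAlgebra ih
    convert hg using 1
    ext x
    rw [iteratedDeriv_succ, (hd x).deriv]

lemma invMills_nonneg (x : ℝ) : 0 ≤ invMills x := by
  have := gaussTail_pos x
  unfold invMills
  positivity

lemma invMills_mul_pow_le {x : ℝ} (hx : x ≤ 0) (n : ℕ) :
    invMills x * (1 + max (-x) 0) ^ n ≤
      n.factorial * Real.exp (3 / 2) / (Real.sqrt (2 * Real.pi) * gaussTail 0) := by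
  have hT := gaussTail_pos 0
  have h1 : invMills x ≤ Real.exp (-x ^ 2 / 2) / (Real.sqrt (2 * Real.pi) * gaussTail 0) := by
    unfold invMills
    gcongr
    exact gaussTail_antitone hx
  rw [max_eq_left (by linarith)]
  have h2 : (1 + -x) ^ n ≤ n.factorial * Real.exp (1 + -x) := by
    have := Real.pow_div_factorial_le_exp (x := 1 + -x) (by linarith) n
    rwa [div_le_iff₀' (by positivity)] at this
  have h3 : Real.exp (-x ^ 2 / 2) * Real.exp (1 + -x) ≤ Real.exp (3 / 2) := by
    rw [← Real.exp_add, Real.exp_le_exp]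
    nlinarith [sq_nonneg (x + 1)]
  calc invMills x * (1 + -x) ^ n
      ≤ Real.exp (-x ^ 2 / 2) / (Real.sqrt (2 * Real.pi) * gaussTail 0) *
          (n.factorial * Real.exp (1 + -x)) :=
        mul_le_mul h1 h2 (pow_nonneg (by linarith) n) (by positivity)
    _ = n.factorial * (Real.exp (-x ^ 2 / 2) * Real.exp (1 + -x)) /
          (Real.sqrt (2 * Real.pi) * gaussTail 0) := by ring
    _ ≤ _ := by gcongr

/-- Lemma 4.4, item (v): for every integer `k ≥ 3`, the `k`-th
derivative of the inverse Mills ratio is bounded on `ℝ`. -/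
theorem statement_14 (k : ℕ) (hk : 3 ≤ k) :
    ∃ C : ℝ, ∀ x : ℝ, |iteratedDeriv k invMills x| ≤ C := by
  obtain ⟨m, rfl⟩ : ∃ m, k = m + 1 := ⟨k - 1, by omega⟩
  obtain ⟨C, n, -, hpos⟩ := negPolyGrowth_of_mem_millsAlgebra (iteratedDeriv_succ_invMills_mem m)
  obtain ⟨f, hf, hfeq⟩ := exists_iteratedDeriv_invMills_eq_mul (m + 1)
  obtain ⟨D, l, hD, hneg⟩ := negPolyGrowth_of_mem_millsAlgebra hf
  refine ⟨max C
    (D * (l.factorial * Real.exp (3 / 2) / (Real.sqrt (2 * Real.pi) * gaussTail 0))),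
    fun x ↦ ?_⟩
  rcases le_total 0 x with hx | hx
  · refine le_max_of_le_left ((hpos x).trans_eq ?_)
    simp [max_eq_right (neg_nonpos.2 hx)]
  · refine le_max_of_le_right ?_
    rw [hfeq, Pi.mul_apply, abs_mul, abs_of_nonneg (invMills_nonneg x)]
    calc invMills x * |f x| ≤ invMills x * (D * (1 + max (-x) 0) ^ l) :=
          mul_le_mul_of_nonneg_left (hneg x) (invMills_nonneg x)
      _ = D * (invMills x * (1 + max (-x) 0) ^ l) := by ring
      _ ≤ _ := mul_le_mul_of_nonneg_left (invMills_mul_pow_le hx l) hD
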